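/- arXiv:2403.13724 — 3 statements merged into one kernel-verified Lean document; each statement's English description precedes it below -/
import Mathlib

section
/- Let d ≥ 1 and let p : ℝ^d → [0,∞) be a probability density satisfying an exponential tail bound: there exist C₁, C₂ > 0 with p(x₁) ≤ C₂ exp(−C₁|x₁|) for all x₁ ∈ ℝ^d. Let α, β, σ : [0,1] → ℝ be C¹ with α(0) = 1, β(0) = 0, β'(0) = 0, β_s > 0 for s ∈ (0,1], and σ(0) > 0. Define b_s(x,x₀) = α'_s x₀ + β'_s η₁(s,x,x₀) + σ'_s (x − α_s x₀ − β_s η₁(s,x,x₀))/σ_s. Then for every fixed x, x₀ ∈ ℝ^d, the Jacobian in x of b_s satisfies lim_{s→0⁺} D_x b_s(x,x₀) = (σ'(0)/σ(0))·I_d, where I_d is the d×d identity matrix. -/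
open MeasureTheory Filter Topology

/-- The conditional-mean function `η₁(s,x,x₀)` of the stochastic interpolant, written as a ratio of
Gaussian-smoothed integrals against the density `p`. -/
noncomputable def eta1 {d : ℕ} (p : EuclideanSpace ℝ (Fin d) → ℝ) (αs βs σs s : ℝ)
    (x x₀ : EuclideanSpace ℝ (Fin d)) : EuclideanSpace ℝ (Fin d) :=
  (∫ x₁, p x₁ * Real.exp (-‖x - αs • x₀ - βs • x₁‖ ^ 2 / (2 * s * σs ^ 2)))⁻¹ •
    ∫ x₁, (p x₁ * Real.exp (-‖x - αs • x₀ - βs • x₁‖ ^ 2 / (2 * s * σs ^ 2))) • x₁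

/-- The drift `b_s(x,x₀) = α'_s x₀ + β'_s η₁ + σ'_s (x − α_s x₀ − β_s η₁)/σ_s` of the
forecasting SDE. -/
noncomputable def drift {d : ℕ} (p : EuclideanSpace ℝ (Fin d) → ℝ)
    (αs βs σs αs' βs' σs' s : ℝ) (x x₀ : EuclideanSpace ℝ (Fin d)) :
    EuclideanSpace ℝ (Fin d) :=
  αs' • x₀ + βs' • eta1 p αs βs σs s x x₀ +
    (σs' / σs) • (x - αs • x₀ - βs • eta1 p αs βs σs s x x₀)


lemma aux_integrable {d : ℕ} (C₁ C₂ : ℝ) (hC₁ : 0 < C₁) (hd : 1 ≤ d) :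
    Integrable (fun x : EuclideanSpace ℝ (Fin d) =>
      C₂ * Real.exp (-(C₁ / 2) * ‖x‖) * (1 + ‖x‖) ^ 2) := by
  haveI : Nonempty (Fin d) := ⟨⟨0, hd⟩⟩
  have h := (integrable_fun_norm_addHaar (E := EuclideanSpace ℝ (Fin d)) volume
    (f := fun r : ℝ => C₂ * Real.exp (-(C₁ / 2) * r) * (1 + r) ^ 2)).2 ?_
  · exact h
  have hk : ∀ k : ℕ, IntegrableOn (fun r : ℝ => r ^ k * Real.exp (-(C₁ / 2) * r)) (Set.Ioi 0) := by
    intro k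
    have := integrableOn_rpow_mul_exp_neg_mul_rpow (s := (k : ℝ)) (p := 1) (b := C₁ / 2)
      (by linarith [(Nat.cast_nonneg k : (0:ℝ) ≤ k)]) one_pos (by positivity)
    simpa using this
  set n := Module.finrank ℝ (EuclideanSpace ℝ (Fin d)) - 1
  have := (((hk n).add ((hk (n+1)).const_mul 2)).add (hk (n+2))).const_mul C₂
  refine this.congr (Filter.Eventually.of_forall fun r => ?_)
  simp only [Pi.add_apply, smul_eq_mul]
  ring

lemma aux_deriv {d : ℕ} {F : Type*} [NormedAddCommGroup F] [NormedSpace ℝ F] [CompleteSpace F]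
    [MeasurableSpace F] [BorelSpace F] [SecondCountableTopology F]
    (hd : 1 ≤ d)
    (q : EuclideanSpace ℝ (Fin d) → ℝ) (hq0 : ∀ x₁, 0 ≤ q x₁) (hqm : AEStronglyMeasurable q volume)
    (C₁ C₂ : ℝ) (hC₁ : 0 < C₁)
    (htail : ∀ x₁, q x₁ ≤ C₂ * Real.exp (-C₁ * ‖x₁‖))
    (f : EuclideanSpace ℝ (Fin d) → F) (hf : Continuous f) (hfb : ∀ x, ‖f x‖ ≤ 1 + ‖x‖)
    (u : EuclideanSpace ℝ (Fin d)) (hu : ‖u‖ < C₁ / 2) :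
    Integrable (fun x => (q x * Real.exp (inner ℝ u x)) • f x) ∧
    ‖∫ x, (q x * Real.exp (inner ℝ u x)) • f x‖ ≤ ∫ x : EuclideanSpace ℝ (Fin d),
      C₂ * Real.exp (-(C₁ / 2) * ‖x‖) * (1 + ‖x‖) ^ 2 ∧
    ∃ D : EuclideanSpace ℝ (Fin d) →L[ℝ] F,
      HasFDerivAt (fun v => ∫ x, (q x * Real.exp (inner ℝ v x)) • f x) D u ∧
      ‖D‖ ≤ ∫ x : EuclideanSpace ℝ (Fin d),
        C₂ * Real.exp (-(C₁ / 2) * ‖x‖) * (1 + ‖x‖) ^ 2 := by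
  have hB := aux_integrable (d := d) C₁ C₂ hC₁ hd
  have hw : ∀ v : EuclideanSpace ℝ (Fin d), ‖v‖ < C₁ / 2 → ∀ x,
      ‖q x * Real.exp (inner ℝ v x)‖ ≤ C₂ * Real.exp (-(C₁ / 2) * ‖x‖) := by
    intro v hv x
    rw [Real.norm_of_nonneg (mul_nonneg (hq0 x) (Real.exp_pos _).le)]
    have h1 : inner ℝ v x ≤ C₁ / 2 * ‖x‖ := (real_inner_le_norm v x).trans (by gcongr)
    calc q x * Real.exp (inner ℝ v x) ≤ (C₂ * Real.exp (-C₁ * ‖x‖)) * Real.exp (C₁ / 2 * ‖x‖) :=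
          mul_le_mul (htail x) (Real.exp_le_exp.2 h1) (Real.exp_pos _).le ((hq0 x).trans (htail x))
      _ = _ := by rw [mul_assoc, ← Real.exp_add]; ring_nf
  have hm : ∀ v : EuclideanSpace ℝ (Fin d),
      AEStronglyMeasurable (fun x => (q x * Real.exp (inner ℝ v x)) • f x) volume := fun v =>
    (hqm.mul (by fun_prop : Continuous fun x => Real.exp (inner ℝ v x)).aestronglyMeasurable).smul
      hf.aestronglyMeasurable
  have hb1 : ∀ x, ‖(q x * Real.exp (inner ℝ u x)) • f x‖ ≤
      C₂ * Real.exp (-(C₁ / 2) * ‖x‖) * (1 + ‖x‖) ^ 2 := by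
    intro x
    rw [norm_smul]
    refine mul_le_mul (hw u hu x) ((hfb x).trans ?_) (norm_nonneg _)
      ((norm_nonneg _).trans (hw u hu x))
    nlinarith [norm_nonneg x]
  have hint : Integrable (fun x => (q x * Real.exp (inner ℝ u x)) • f x) :=
    hB.mono' (hm u) (Eventually.of_forall hb1)
  have hb2 : ∀ v : EuclideanSpace ℝ (Fin d), ‖v‖ < C₁ / 2 → ∀ x,
      ‖(q x * Real.exp (inner ℝ v x)) • (innerSL ℝ x).smulRight (f x)‖ ≤
      C₂ * Real.exp (-(C₁ / 2) * ‖x‖) * (1 + ‖x‖) ^ 2 := by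
    intro v hv x
    rw [norm_smul, ContinuousLinearMap.norm_smulRight_apply, innerSL_apply_norm]
    refine mul_le_mul (hw v hv x) ?_ (by positivity) ((norm_nonneg _).trans (hw v hv x))
    nlinarith [norm_nonneg x, hfb x, norm_nonneg (f x)]
  refine ⟨hint, norm_integral_le_of_norm_le hB (Eventually.of_forall hb1),
    ∫ x, (q x * Real.exp (inner ℝ u x)) • (innerSL ℝ x).smulRight (f x), ?_,
    norm_integral_le_of_norm_le hB (Eventually.of_forall (hb2 u hu))⟩
  refine hasFDerivAt_integral_of_dominated_of_fderiv_le (s := Metric.ball 0 (C₁ / 2))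
    (Metric.isOpen_ball.mem_nhds (by simpa using hu)) (Eventually.of_forall hm) hint ?_
    (Eventually.of_forall fun x v hv => hb2 v (by simpa using hv) x) hB
    (Eventually.of_forall fun x v hv => ?_)
  · refine (hqm.mul
      (by fun_prop : Continuous fun x => Real.exp (inner ℝ u x)).aestronglyMeasurable).smul ?_
    refine Continuous.aestronglyMeasurable ?_
    exact ((ContinuousLinearMap.smulRightL ℝ (EuclideanSpace ℝ (Fin d)) F).continuous₂).comp
      ((innerSL ℝ).continuous.prodMk hf)
  · have h0 : HasFDerivAt (fun v : EuclideanSpace ℝ (Fin d) => inner ℝ v x) (innerSL ℝ x) v := by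
      have := (innerSL ℝ x).hasFDerivAt (x := v)
      refine this.congr_of_eventuallyEq (Eventually.of_forall fun w => ?_)
      simp [real_inner_comm]
    have := ((h0.exp).const_mul (q x)).smul_const (f x)
    refine this.congr_fderiv ?_
    ext w
    simp [smul_smul]
    

lemma aux_H {d : ℕ} (hd : 1 ≤ d)
    (p : EuclideanSpace ℝ (Fin d) → ℝ) (hp0 : ∀ x₁, 0 ≤ p x₁)
    (hpd : ∫ x₁, p x₁ = 1)
    (C₁ C₂ : ℝ) (hC₁ : 0 < C₁)
    (htail : ∀ x₁, p x₁ ≤ C₂ * Real.exp (-C₁ * ‖x₁‖)) :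
    ∃ K : ℝ, ∀ ε : ℝ, 0 ≤ ε → ε ≤ 1 → ∀ u : EuclideanSpace ℝ (Fin d), ‖u‖ < C₁ / 2 →
      ∃ D : EuclideanSpace ℝ (Fin d) →L[ℝ] EuclideanSpace ℝ (Fin d), ‖D‖ ≤ K ∧
        HasFDerivAt (fun v =>
          (∫ x, (p x * Real.exp (-ε * ‖x‖ ^ 2)) * Real.exp (inner ℝ v x))⁻¹ •
          ∫ x, ((p x * Real.exp (-ε * ‖x‖ ^ 2)) * Real.exp (inner ℝ v x)) • x) D u := by
  have hpi : Integrable p := by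
    by_contra h
    rw [integral_undef h] at hpd
    norm_num at hpd
  set B := ∫ x : EuclideanSpace ℝ (Fin d), C₂ * Real.exp (-(C₁ / 2) * ‖x‖) * (1 + ‖x‖) ^ 2 with hBdef
  set l : EuclideanSpace ℝ (Fin d) → ℝ := fun x =>
    p x * Real.exp (-(‖x‖ ^ 2) - C₁ / 2 * ‖x‖) with hl
  have hli : Integrable l := by
    refine hpi.mono' (hpi.aestronglyMeasurable.mul
      (by fun_prop : Continuous fun x : EuclideanSpace ℝ (Fin d) =>
        Real.exp (-(‖x‖ ^ 2) - C₁ / 2 * ‖x‖)).aestronglyMeasurable) (Eventually.of_forall fun x => ?_)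
    rw [Real.norm_of_nonneg (mul_nonneg (hp0 x) (Real.exp_pos _).le)]
    refine mul_le_of_le_one_right (hp0 x) (Real.exp_le_one_iff.2 ?_)
    have := norm_nonneg x
    have := mul_nonneg hC₁.le this
    nlinarith [sq_nonneg ‖x‖]
  have hl0 : 0 ≤ l := fun x => mul_nonneg (hp0 x) (Real.exp_pos _).le
  set c := ∫ x, l x with hc
  have hcpos : 0 < c := by
    have h1 : 0 < ∫ x, p x := by rw [hpd]; exact one_pos
    rw [integral_pos_iff_support_of_nonneg hp0 hpi] at h1
    rw [hc, integral_pos_iff_support_of_nonneg hl0 hli]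
    convert h1 using 2
    ext x
    simp [hl]
  refine ⟨c⁻¹ * B + (c ^ 2)⁻¹ * B * B, fun ε hε0 hε1 u hu => ?_⟩
  set q : EuclideanSpace ℝ (Fin d) → ℝ := fun x => p x * Real.exp (-ε * ‖x‖ ^ 2) with hq
  have hq0 : ∀ x, 0 ≤ q x := fun x => mul_nonneg (hp0 x) (Real.exp_pos _).le
  have hqm : AEStronglyMeasurable q volume := hpi.aestronglyMeasurable.mul
      (by fun_prop : Continuous fun x : EuclideanSpace ℝ (Fin d) =>
        Real.exp (-ε * ‖x‖ ^ 2)).aestronglyMeasurable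
  have hqt : ∀ x, q x ≤ C₂ * Real.exp (-C₁ * ‖x‖) := fun x => by
    refine le_trans ?_ (htail x)
    refine mul_le_of_le_one_right (hp0 x) (Real.exp_le_one_iff.2 ?_)
    nlinarith [mul_nonneg hε0 (sq_nonneg ‖x‖)]
  obtain ⟨hZi, hZb, Z', hZ', hZ'b⟩ := aux_deriv hd q hq0 hqm C₁ C₂ hC₁ hqt (fun _ => (1 : ℝ))
    continuous_const (fun x => by simp) u hu
  obtain ⟨hMi, hMb, M', hM', hM'b⟩ := aux_deriv hd q hq0 hqm C₁ C₂ hC₁ hqt (fun x => x)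
    continuous_id (fun x => by linarith) u hu
  simp only [smul_eq_mul, mul_one] at hZi hZb hZ'
  set Z := fun v : EuclideanSpace ℝ (Fin d) => ∫ x, q x * Real.exp (inner ℝ v x) with hZ
  set M := fun v : EuclideanSpace ℝ (Fin d) => ∫ x, (q x * Real.exp (inner ℝ v x)) • x with hM
  have hZc : c ≤ Z u := by
    refine integral_mono hli hZi fun x => ?_
    simp only [hl, hq, mul_assoc, ← Real.exp_add]
    refine mul_le_mul_of_nonneg_left (Real.exp_le_exp.2 ?_) (hp0 x)
    have h1 : -(C₁ / 2 * ‖x‖) ≤ inner ℝ u x := by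
      have := (abs_le.1 (abs_real_inner_le_norm u x)).1
      have : ‖u‖ * ‖x‖ ≤ C₁ / 2 * ‖x‖ := by gcongr
      linarith
    nlinarith [mul_nonneg (sub_nonneg.2 hε1) (sq_nonneg ‖x‖)]
  have hZpos : 0 < Z u := hcpos.trans_le hZc
  have hB0 : 0 ≤ B := (norm_nonneg _).trans hZ'b
  have hinv : HasFDerivAt (fun v => (Z v)⁻¹) (-((Z u) ^ 2)⁻¹ • Z') u :=
    (hasDerivAt_inv hZpos.ne').comp_hasFDerivAt u hZ'
  refine ⟨_, ?_, hinv.smul hM'⟩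
  refine (norm_add_le _ _).trans (add_le_add ?_ ?_)
  · rw [norm_smul, Real.norm_of_nonneg (inv_nonneg.2 hZpos.le)]
    exact mul_le_mul (by gcongr) hM'b (norm_nonneg _) (by positivity)
  · rw [ContinuousLinearMap.norm_smulRight_apply, norm_smul, norm_neg,
      Real.norm_of_nonneg (by positivity)]
    refine mul_le_mul (mul_le_mul (by gcongr) hZ'b (norm_nonneg _) (by positivity)) hMb
      (norm_nonneg _) (by positivity)

lemma aux_eta {d : ℕ} (p : EuclideanSpace ℝ (Fin d) → ℝ) (a b σ s : ℝ) (hs : s ≠ 0) (hσ : σ ≠ 0)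
    (y x₀ : EuclideanSpace ℝ (Fin d)) :
    eta1 p a b σ s y x₀ =
      (fun v : EuclideanSpace ℝ (Fin d) =>
          (∫ x, (p x * Real.exp (-(b ^ 2 / (2 * s * σ ^ 2)) * ‖x‖ ^ 2)) * Real.exp (inner ℝ v x))⁻¹ •
          ∫ x, ((p x * Real.exp (-(b ^ 2 / (2 * s * σ ^ 2)) * ‖x‖ ^ 2)) *
            Real.exp (inner ℝ v x)) • x) ((b / (s * σ ^ 2)) • (y - a • x₀)) := by
  unfold eta1
  have key : ∀ x, p x * Real.exp (-‖y - a • x₀ - b • x‖ ^ 2 / (2 * s * σ ^ 2)) =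
      Real.exp (-‖y - a • x₀‖ ^ 2 / (2 * s * σ ^ 2)) *
      ((p x * Real.exp (-(b ^ 2 / (2 * s * σ ^ 2)) * ‖x‖ ^ 2)) *
        Real.exp (inner ℝ ((b / (s * σ ^ 2)) • (y - a • x₀)) x)) := by
    intro x
    have : Real.exp (-‖y - a • x₀ - b • x‖ ^ 2 / (2 * s * σ ^ 2)) =
      Real.exp (-‖y - a • x₀‖ ^ 2 / (2 * s * σ ^ 2)) *
      (Real.exp (-(b ^ 2 / (2 * s * σ ^ 2)) * ‖x‖ ^ 2) *
        Real.exp (inner ℝ ((b / (s * σ ^ 2)) • (y - a • x₀)) x)) := by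
      rw [← Real.exp_add, ← Real.exp_add, norm_sub_sq_real, inner_smul_left, inner_smul_right,
        norm_smul, mul_pow, Real.norm_eq_abs, sq_abs]
      congr 1
      simp only [conj_trivial]
      field_simp
      ring
    rw [this]; ring
  simp only [key, mul_smul (Real.exp (-‖y - a • x₀‖ ^ 2 / (2 * s * σ ^ 2)))]
  rw [integral_const_mul, integral_smul, smul_smul, mul_inv]
  congr 1
  have := (Real.exp_pos (-‖y - a • x₀‖ ^ 2 / (2 * s * σ ^ 2))).ne'
  rw [mul_right_comm, inv_mul_cancel₀ this, one_mul]

/-- For a probability density with exponential tails and C¹ interpolant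
coefficients with `α(0) = 1`, `β(0) = 0`, `β'(0) = 0`, `σ(0) > 0`, the Jacobian in `x` of the
drift `b_s(x,x₀)` converges to `(σ'(0)/σ(0)) · I_d` as `s → 0⁺`. -/
theorem drift_jacobian_limit_at_zero
    (d : ℕ) (hd : 1 ≤ d)
    (p : EuclideanSpace ℝ (Fin d) → ℝ) (hp0 : ∀ x₁, 0 ≤ p x₁)
    (hpd : ∫ x₁, p x₁ = 1)
    (C₁ C₂ : ℝ) (hC₁ : 0 < C₁) (hC₂ : 0 < C₂)
    (htail : ∀ x₁, p x₁ ≤ C₂ * Real.exp (-C₁ * ‖x₁‖))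
    (α β σ α' β' σ' : ℝ → ℝ)
    (hα : ∀ u ∈ Set.Icc (0 : ℝ) 1, HasDerivWithinAt α (α' u) (Set.Icc 0 1) u)
    (hβ : ∀ u ∈ Set.Icc (0 : ℝ) 1, HasDerivWithinAt β (β' u) (Set.Icc 0 1) u)
    (hσ : ∀ u ∈ Set.Icc (0 : ℝ) 1, HasDerivWithinAt σ (σ' u) (Set.Icc 0 1) u)
    (hα'c : ContinuousOn α' (Set.Icc 0 1)) (hβ'c : ContinuousOn β' (Set.Icc 0 1))
    (hσ'c : ContinuousOn σ' (Set.Icc 0 1))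
    (hα0 : α 0 = 1) (hβ0 : β 0 = 0) (hβ'0 : β' 0 = 0)
    (hβpos : ∀ s ∈ Set.Ioc (0 : ℝ) 1, 0 < β s)
    (hσ0 : 0 < σ 0) :
    ∀ x x₀ : EuclideanSpace ℝ (Fin d),
      Tendsto
        (fun s => fderiv ℝ (fun y => drift p (α s) (β s) (σ s) (α' s) (β' s) (σ' s) s y x₀) x)
        (nhdsWithin 0 (Set.Ioc 0 1))
        (nhds ((σ' 0 / σ 0) • ContinuousLinearMap.id ℝ (EuclideanSpace ℝ (Fin d)))) := by
  intro x x₀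
  obtain ⟨K, hK⟩ := aux_H hd p hp0 hpd C₁ C₂ hC₁ htail
  set l := nhdsWithin (0 : ℝ) (Set.Ioc 0 1) with hl
  have hle : l ≤ nhdsWithin (0 : ℝ) (Set.Icc 0 1) := nhdsWithin_mono _ Set.Ioc_subset_Icc_self
  have h0 : (0 : ℝ) ∈ Set.Icc (0 : ℝ) 1 := by simp
  have tα : Tendsto α l (𝓝 1) := by
    have := ((hα 0 h0).continuousWithinAt.tendsto).mono_left hle
    rwa [hα0] at this
  have tβ : Tendsto β l (𝓝 0) := by
    have := ((hβ 0 h0).continuousWithinAt.tendsto).mono_left hle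
    rwa [hβ0] at this
  have tσ : Tendsto σ l (𝓝 (σ 0)) := ((hσ 0 h0).continuousWithinAt.tendsto).mono_left hle
  have tσ' : Tendsto σ' l (𝓝 (σ' 0)) := (hσ'c 0 h0).tendsto.mono_left hle
  have tβ' : Tendsto β' l (𝓝 0) := by
    have := (hβ'c 0 h0).tendsto.mono_left hle
    rwa [hβ'0] at this
  have tβs : Tendsto (fun s => β s / s) l (𝓝 0) := by
    have h1 := hasDerivWithinAt_iff_tendsto_slope.1 (hβ 0 h0)
    rw [hβ'0] at h1
    have h2 : l ≤ nhdsWithin (0 : ℝ) (Set.Icc 0 1 \ {0}) := by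
      refine nhdsWithin_mono _ fun s hs => ⟨Set.Ioc_subset_Icc_self hs, ?_⟩
      simpa using hs.1.ne'
    refine (h1.mono_left h2).congr fun s => ?_
    simp [slope_def_field, hβ0]
  have tκ : Tendsto (fun s => β s / (s * σ s ^ 2)) l (𝓝 0) := by
    have := tβs.div (tσ.pow 2) (by positivity)
    simp only [zero_div] at this
    refine this.congr fun s => ?_
    simp [div_div]
  have tε : Tendsto (fun s => β s ^ 2 / (2 * s * σ s ^ 2)) l (𝓝 0) := by
    have := (tβ.mul tκ).div_const 2
    simp only [mul_zero, zero_div] at this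
    refine this.congr fun s => ?_
    simp only [div_eq_mul_inv, mul_inv]
    ring
  have tu : Tendsto (fun s => ‖(β s / (s * σ s ^ 2)) • (x - α s • x₀)‖) l (𝓝 0) := by
    have := (tκ.smul (tendsto_const_nhds (x := x) |>.sub (tα.smul_const x₀))).norm
    simpa using this
  have tq : Tendsto (fun s => σ' s / σ s) l (𝓝 (σ' 0 / σ 0)) := tσ'.div tσ hσ0.ne'
  have tg : Tendsto (fun s => ‖(β' s - σ' s / σ s * β s) * (β s / (s * σ s ^ 2))‖ * K) l (𝓝 0) := by
    have := (((tβ'.sub (tq.mul tβ)).mul tκ).norm).mul_const K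
    simpa using this
  have hmem : ∀ᶠ s in l, s ∈ Set.Ioc (0 : ℝ) 1 := self_mem_nhdsWithin
  have hbound : ∀ᶠ s in l,
      ‖fderiv ℝ (fun y => drift p (α s) (β s) (σ s) (α' s) (β' s) (σ' s) s y x₀) x -
        (σ' s / σ s) • ContinuousLinearMap.id ℝ (EuclideanSpace ℝ (Fin d))‖ ≤
      ‖(β' s - σ' s / σ s * β s) * (β s / (s * σ s ^ 2))‖ * K := by
    filter_upwards [hmem, tσ.eventually (lt_mem_nhds hσ0),
      tε.eventually (gt_mem_nhds one_pos),
      tu.eventually (gt_mem_nhds (half_pos hC₁))] with s hs hσs hεs hus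
    have hs0 := hs.1
    obtain ⟨D, hDK, hD⟩ := hK (β s ^ 2 / (2 * s * σ s ^ 2)) (by positivity) hεs.le _ hus
    have hin : HasFDerivAt (fun y => (β s / (s * σ s ^ 2)) • (y - α s • x₀))
        ((β s / (s * σ s ^ 2)) • ContinuousLinearMap.id ℝ (EuclideanSpace ℝ (Fin d))) x :=
      ((hasFDerivAt_id (𝕜 := ℝ) x).sub_const (α s • x₀)).const_smul (β s / (s * σ s ^ 2))
    have he := HasFDerivAt.comp x hD hin
    have he' : HasFDerivAt (fun y => eta1 p (α s) (β s) (σ s) s y x₀)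
        ((β s / (s * σ s ^ 2)) • D) x := by
      refine (he.congr_of_eventuallyEq (Eventually.of_forall fun y => ?_)).congr_fderiv ?_
      · exact aux_eta p (α s) (β s) (σ s) s hs0.ne' hσs.ne' y x₀
      · ext1 w
        simp
    have hdr : HasFDerivAt (fun y => drift p (α s) (β s) (σ s) (α' s) (β' s) (σ' s) s y x₀)
        (β' s • ((β s / (s * σ s ^ 2)) • D) + (σ' s / σ s) •
          (ContinuousLinearMap.id ℝ (EuclideanSpace ℝ (Fin d)) -
            β s • ((β s / (s * σ s ^ 2)) • D))) x := by
      unfold drift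
      exact ((he'.const_smul (β' s)).const_add _).add
        ((((hasFDerivAt_id (𝕜 := ℝ) x).sub_const (α s • x₀)).sub
          (he'.const_smul (β s))).const_smul (σ' s / σ s))
    rw [hdr.fderiv]
    have : (β' s • ((β s / (s * σ s ^ 2)) • D) + (σ' s / σ s) •
          (ContinuousLinearMap.id ℝ (EuclideanSpace ℝ (Fin d)) -
            β s • ((β s / (s * σ s ^ 2)) • D))) -
        (σ' s / σ s) • ContinuousLinearMap.id ℝ (EuclideanSpace ℝ (Fin d)) =
        ((β' s - σ' s / σ s * β s) * (β s / (s * σ s ^ 2))) • D := by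
      module
    rw [this, norm_smul]
    exact mul_le_mul_of_nonneg_left hDK (norm_nonneg _)
  have hz := squeeze_zero_norm' hbound tg
  have := hz.add (tq.smul_const (ContinuousLinearMap.id ℝ (EuclideanSpace ℝ (Fin d))))
  simpa using this
end

section
/- Fix d ≥ 1, s ∈ (0,1), and reals α_s, β_s > 0, σ_s > 0, α'_s, β'_s, σ'_s with β'_s σ_s − β_s σ'_s ≠ 0. Let p : ℝ^d → [0,∞) be a probability density with exponential tail bound p(x₁) ≤ C₂ exp(−C₁|x₁|), C₁, C₂ > 0, not a.e. zero. Define ρ_s(x|x₀) = (2π s σ_s²)^{−d/2} ∫_{ℝ^d} p(x₁) exp(−|x−α_s x₀−β_s x₁|²/(2 s σ_s²)) dx₁, b_s(x,x₀) = α'_s x₀ + β'_s η₁(s,x,x₀) + σ'_s (x − α_s x₀ − β_s η₁(s,x,x₀))/σ_s, A_s = 1/(s σ_s (β'_s σ_s − β_s σ'_s)), and c_s(x,x₀) = β'_s x + (β_s α'_s − β'_s α_s) x₀. Then for all x, x₀ ∈ ℝ^d: ∇_x log ρ_s(x|x₀) = A_s (β_s b_s(x,x₀) − c_s(x,x₀)).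 -/
open MeasureTheory

/-- The density `ρ_s(x|x₀)` of the stochastic interpolant. -/
noncomputable def interpDensity {d : ℕ} (p : EuclideanSpace ℝ (Fin d) → ℝ) (αs βs σs s : ℝ)
    (x x₀ : EuclideanSpace ℝ (Fin d)) : ℝ :=
  (2 * Real.pi * s * σs ^ 2) ^ (-(d : ℝ) / 2) *
    ∫ x₁, p x₁ * Real.exp (-‖x - αs • x₀ - βs • x₁‖ ^ 2 / (2 * s * σs ^ 2))

lemma kernel_bound (D t : ℝ) (hD : 0 < D) (ht : 0 ≤ t) :
    t * Real.exp (-t ^ 2 / D) ≤ D + 1 := by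
  have h1 := Real.add_one_le_exp (t ^ 2 / D)
  have h2 : Real.exp (-t ^ 2 / D) = (Real.exp (t ^ 2 / D))⁻¹ := by
    rw [← Real.exp_neg]; ring_nf
  rw [h2, ← div_eq_mul_inv, div_le_iff₀ (Real.exp_pos _)]
  have h3 : (D + 1) * (t ^ 2 / D + 1) ≤ (D + 1) * Real.exp (t ^ 2 / D) := by gcongr
  have h4 : (D + 1) * (t ^ 2 / D + 1) = t ^ 2 + t ^ 2 / D + D + 1 := by
    field_simp
    ring
  have h5 : 0 ≤ t ^ 2 / D := by positivity
  nlinarith [sq_nonneg (t - 1)]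

lemma kernel_le_one (D t : ℝ) (hD : 0 < D) : Real.exp (-t ^ 2 / D) ≤ 1 := by
  rw [Real.exp_le_one_iff, neg_div]
  have : 0 ≤ t ^ 2 / D := by positivity
  linarith

/-- All the analysis: integrability, and differentiation under the integral sign. -/
lemma smoothing_hasFDerivAt {d : ℕ} (p : EuclideanSpace ℝ (Fin d) → ℝ) (hp0 : ∀ x₁, 0 ≤ p x₁)
    (hp : Integrable p) (b D : ℝ) (hD : 0 < D) (a x : EuclideanSpace ℝ (Fin d)) :
    Integrable (fun x₁ => p x₁ * Real.exp (-‖x - a - b • x₁‖ ^ 2 / D)) ∧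
    Integrable (fun x₁ => (p x₁ * Real.exp (-‖x - a - b • x₁‖ ^ 2 / D)) • (x - a - b • x₁)) ∧
    HasGradientAt (fun y => ∫ x₁, p x₁ * Real.exp (-‖y - a - b • x₁‖ ^ 2 / D))
      ((-2 / D) • ∫ x₁, (p x₁ * Real.exp (-‖x - a - b • x₁‖ ^ 2 / D)) • (x - a - b • x₁)) x := by
  have hm : ∀ y : EuclideanSpace ℝ (Fin d), AEStronglyMeasurable
      (fun x₁ => p x₁ * Real.exp (-‖y - a - b • x₁‖ ^ 2 / D)) := fun y =>
    hp.aestronglyMeasurable.mul (Continuous.aestronglyMeasurable (by fun_prop))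
  have hi : ∀ y : EuclideanSpace ℝ (Fin d), Integrable
      (fun x₁ => p x₁ * Real.exp (-‖y - a - b • x₁‖ ^ 2 / D)) := fun y => by
    refine hp.mono' (hm y) (Filter.Eventually.of_forall fun x₁ => ?_)
    rw [Real.norm_of_nonneg (mul_nonneg (hp0 _) (Real.exp_pos _).le)]
    exact mul_le_of_le_one_right (hp0 _) (kernel_le_one D _ hD)
  have hvm : AEStronglyMeasurable
      (fun x₁ => (p x₁ * Real.exp (-‖x - a - b • x₁‖ ^ 2 / D)) • (x - a - b • x₁)) :=
    (hm x).smul (Continuous.aestronglyMeasurable (by fun_prop))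
  have hbd : ∀ y x₁ : EuclideanSpace ℝ (Fin d),
      ‖(p x₁ * Real.exp (-‖y - a - b • x₁‖ ^ 2 / D)) • (y - a - b • x₁)‖ ≤ (D + 1) * p x₁ := by
    intro y x₁
    rw [norm_smul, Real.norm_of_nonneg (mul_nonneg (hp0 _) (Real.exp_pos _).le)]
    have := mul_le_mul_of_nonneg_left (kernel_bound D ‖y - a - b • x₁‖ hD (norm_nonneg _)) (hp0 x₁)
    linarith
  have hv : Integrable
      (fun x₁ => (p x₁ * Real.exp (-‖x - a - b • x₁‖ ^ 2 / D)) • (x - a - b • x₁)) :=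
    (hp.const_mul (D + 1)).mono' hvm (Filter.Eventually.of_forall fun x₁ => hbd x x₁)
  refine ⟨hi x, hv, ?_⟩
  let F' : EuclideanSpace ℝ (Fin d) → EuclideanSpace ℝ (Fin d) →
      (EuclideanSpace ℝ (Fin d) →L[ℝ] ℝ) := fun y x₁ =>
    InnerProductSpace.toDual ℝ _
      ((-2 / D) • ((p x₁ * Real.exp (-‖y - a - b • x₁‖ ^ 2 / D)) • (y - a - b • x₁)))
  have hF'm : AEStronglyMeasurable (F' x) :=
    (InnerProductSpace.toDual ℝ (EuclideanSpace ℝ (Fin d))).continuous.comp_aestronglyMeasurable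
      (hvm.const_smul (-2 / D))
  have hF'b : ∀ y x₁, ‖F' y x₁‖ ≤ 2 / D * ((D + 1) * p x₁) := by
    intro y x₁
    simp only [F', LinearIsometryEquiv.norm_map]
    rw [norm_smul]
    have : ‖-2 / D‖ = 2 / D := by
      rw [Real.norm_eq_abs, neg_div, abs_neg, abs_of_pos (by positivity)]
    rw [this]
    exact mul_le_mul_of_nonneg_left (hbd y x₁) (by positivity)
  have hbi : Integrable (fun x₁ => 2 / D * ((D + 1) * p x₁)) :=
    (hp.const_mul (D + 1)).const_mul (2 / D)
  have key := hasFDerivAt_integral_of_dominated_of_fderiv_le (𝕜 := ℝ)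
    (F := fun y x₁ => p x₁ * Real.exp (-‖y - a - b • x₁‖ ^ 2 / D)) (F' := F') (x₀ := x)
    (bound := fun x₁ => 2 / D * ((D + 1) * p x₁)) (μ := volume) (s := Set.univ)
    Filter.univ_mem (Filter.Eventually.of_forall hm) (hi x) hF'm
    (Filter.Eventually.of_forall fun x₁ y _ => hF'b y x₁) hbi
    (Filter.Eventually.of_forall fun x₁ y _ => by
      have h0 : HasFDerivAt (fun y : EuclideanSpace ℝ (Fin d) => y - a - b • x₁)
          (ContinuousLinearMap.id ℝ _) y := ((hasFDerivAt_id y).sub_const _).sub_const _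
      have h1 := (((h0.norm_sq).neg.mul_const (D⁻¹)).exp).const_mul (p x₁)
      simp only [← div_eq_mul_inv] at h1
      refine h1.congr_fderiv ?_
      ext v
      simp [F']
      field_simp)
  rw [hasGradientAt_iff_hasFDerivAt]
  refine key.congr_fderiv ?_
  have hF'i : Integrable (F' x) :=
    hbi.mono' hF'm (Filter.Eventually.of_forall fun x₁ => hF'b x x₁)
  have hv2 : Integrable (fun x₁ =>
      (-2 / D) • ((p x₁ * Real.exp (-‖x - a - b • x₁‖ ^ 2 / D)) • (x - a - b • x₁))) :=
    hv.smul (-2 / D)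
  ext v
  rw [ContinuousLinearMap.integral_apply hF'i, ← integral_smul, InnerProductSpace.toDual_apply_apply,
    real_inner_comm, ← integral_inner hv2]
  refine integral_congr_ae (Filter.Eventually.of_forall fun x₁ => ?_)
  simp only [F', InnerProductSpace.toDual_apply_apply]
  exact real_inner_comm _ _

/-- The score of the interpolant density can be expressed in terms of the
drift: `∇_x log ρ_s(x|x₀) = A_s (β_s b_s(x,x₀) − c_s(x,x₀))` with
`A_s = 1/(s σ_s (β'_s σ_s − β_s σ'_s))` and `c_s(x,x₀) = β'_s x + (β_s α'_s − β'_s α_s) x₀`. -/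
theorem score_eq_drift_combination
    (d : ℕ) (hd : 1 ≤ d) (s : ℝ) (hs : s ∈ Set.Ioo (0 : ℝ) 1)
    (αs βs σs αs' βs' σs' : ℝ) (hβ : 0 < βs) (hσ : 0 < σs)
    (hdet : βs' * σs - βs * σs' ≠ 0)
    (p : EuclideanSpace ℝ (Fin d) → ℝ) (hp0 : ∀ x₁, 0 ≤ p x₁)
    (hpd : ∫ x₁, p x₁ = 1)
    (C₁ C₂ : ℝ) (hC₁ : 0 < C₁) (hC₂ : 0 < C₂)
    (htail : ∀ x₁, p x₁ ≤ C₂ * Real.exp (-C₁ * ‖x₁‖))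
    (hpne : ¬ (∀ᵐ x₁, p x₁ = 0))
    (As : ℝ) (hAs : As = 1 / (s * σs * (βs' * σs - βs * σs'))) :
    ∀ x x₀ : EuclideanSpace ℝ (Fin d),
      gradient (fun y => Real.log (interpDensity p αs βs σs s y x₀)) x
        = As • (βs • drift p αs βs σs αs' βs' σs' s x x₀
            - (βs' • x + (βs * αs' - βs' * αs) • x₀)) := by
  intro x x₀
  have hs0 : 0 < s := hs.1
  have hp : Integrable p := by
    by_contra h
    rw [integral_undef h] at hpd
    exact zero_ne_one hpd
  have hD : 0 < 2 * s * σs ^ 2 := by positivity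
  obtain ⟨hi, hv, hg⟩ := smoothing_hasFDerivAt p hp0 hp βs _ hD (αs • x₀) x
  have hZ : 0 < ∫ x₁, p x₁ * Real.exp (-‖x - αs • x₀ - βs • x₁‖ ^ 2 / (2 * s * σs ^ 2)) := by
    have hnn : ∀ x₁, 0 ≤ p x₁ * Real.exp (-‖x - αs • x₀ - βs • x₁‖ ^ 2 / (2 * s * σs ^ 2)) :=
      fun x₁ => mul_nonneg (hp0 _) (Real.exp_pos _).le
    refine lt_of_le_of_ne (integral_nonneg hnn) fun h => hpne ?_
    have h2 := (integral_eq_zero_iff_of_nonneg hnn hi).1 h.symm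
    filter_upwards [h2] with x₁ hx
    exact (mul_eq_zero.1 hx).resolve_right (Real.exp_pos _).ne'
  have hK : 0 < (2 * Real.pi * s * σs ^ 2) ^ (-(d : ℝ) / 2) := by
    have := Real.pi_pos
    positivity
  have hx1 : ∫ x₁, (p x₁ * Real.exp (-‖x - αs • x₀ - βs • x₁‖ ^ 2 / (2 * s * σs ^ 2))) •
        (x - αs • x₀ - βs • x₁) =
      (∫ x₁, p x₁ * Real.exp (-‖x - αs • x₀ - βs • x₁‖ ^ 2 / (2 * s * σs ^ 2))) •
        (x - αs • x₀ - βs • eta1 p αs βs σs s x x₀) := by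
    have hw : Integrable (fun x₁ =>
        (p x₁ * Real.exp (-‖x - αs • x₀ - βs • x₁‖ ^ 2 / (2 * s * σs ^ 2))) • x₁) := by
      have := ((hi.smul_const (x - αs • x₀)).sub hv).smul βs⁻¹
      refine this.congr (Filter.Eventually.of_forall fun x₁ => ?_)
      simp only [Pi.smul_apply, Pi.sub_apply]
      rw [← smul_sub, sub_sub_cancel, smul_comm, smul_smul βs⁻¹, inv_mul_cancel₀ hβ.ne', one_smul]
    have e : ∀ x₁, (p x₁ * Real.exp (-‖x - αs • x₀ - βs • x₁‖ ^ 2 / (2 * s * σs ^ 2))) •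
        (x - αs • x₀ - βs • x₁) =
        (p x₁ * Real.exp (-‖x - αs • x₀ - βs • x₁‖ ^ 2 / (2 * s * σs ^ 2))) • (x - αs • x₀) -
        βs • ((p x₁ * Real.exp (-‖x - αs • x₀ - βs • x₁‖ ^ 2 / (2 * s * σs ^ 2))) • x₁) := by
      intro x₁
      rw [smul_sub, smul_comm βs]
    have hw2 : Integrable (fun x₁ => βs •
        ((p x₁ * Real.exp (-‖x - αs • x₀ - βs • x₁‖ ^ 2 / (2 * s * σs ^ 2))) • x₁)) := hw.smul βs
    rw [integral_congr_ae (Filter.Eventually.of_forall e),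
      integral_sub (hi.smul_const _) hw2, integral_smul_const, integral_smul, eta1,
      smul_sub _ (x - αs • x₀) (βs • _), smul_comm _ βs, smul_smul _ _⁻¹, mul_inv_cancel₀ hZ.ne', one_smul]
  rw [hx1] at hg
  have hlog := ((hasGradientAt_iff_hasFDerivAt.1 hg).const_mul
    ((2 * Real.pi * s * σs ^ 2) ^ (-(d : ℝ) / 2))).log (mul_pos hK hZ).ne'
  have hfin : HasGradientAt (fun y => Real.log (interpDensity p αs βs σs s y x₀))
      ((-1 / (s * σs ^ 2)) • (x - αs • x₀ - βs • eta1 p αs βs σs s x x₀)) x := by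
    rw [hasGradientAt_iff_hasFDerivAt]
    refine hlog.congr_fderiv ?_
    ext v
    simp only [smul_smul, smul_apply, InnerProductSpace.toDual_apply_apply,
      real_inner_smul_left, smul_eq_mul]
    rw [← mul_assoc]
    congr 1
    generalize (∫ x₁, p x₁ * Real.exp (-‖x - αs • x₀ - βs • x₁‖ ^ 2 / (2 * s * σs ^ 2))) = Z at *
    generalize (2 * Real.pi * s * σs ^ 2) ^ (-(d : ℝ) / 2) = K at *
    have := hZ.ne'
    have := hK.ne'
    field_simp
  have hA : As * (βs' * σs - βs * σs') = 1 / (s * σs) := by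
    have := hs0.ne'
    have := hσ.ne'
    rw [hAs, eq_div_iff (by positivity), one_div, mul_assoc, mul_comm (βs' * σs - βs * σs')]
    exact inv_mul_cancel₀ (by positivity)
  rw [hfin.gradient, drift]
  generalize eta1 p αs βs σs s x x₀ = η
  ext i
  simp only [PiLp.smul_apply, PiLp.sub_apply, PiLp.add_apply, smul_eq_mul]
  have e1 : βs * (αs' * x₀ i + βs' * η i + σs' / σs * (x i - αs * x₀ i - βs * η i)) -
      (βs' * x i + (βs * αs' - βs' * αs) * x₀ i) =
      -((βs' * σs - βs * σs') / σs) * (x i - αs * x₀ i - βs * η i) := by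
    field_simp
    ring
  rw [e1]
  have e2 : As * (-((βs' * σs - βs * σs') / σs) * (x i - αs * x₀ i - βs * η i)) =
      -(As * (βs' * σs - βs * σs')) / σs * (x i - αs * x₀ i - βs * η i) := by ring
  rw [e2, hA]
  field_simp
end

section
/- Let β, σ : [0,δ) → ℝ for some δ > 0 with β(0) = 0, β'(0) > 0, β twice differentiable at 0 (with β''(0) existing), β_s > 0 on (0,δ), σ ∈ C¹ with σ(0) > 0. Define |g^F_s|² = 2 s σ_s (β_s^{-1} β'_s σ_s − σ'_s) − σ_s² for s ∈ (0,δ). Then lim_{s→0⁺} s^{-1}(|g^F_s|² − σ_s²) = σ(0)² β''(0)/β'(0) − 2σ'(0)σ(0). -/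
open Filter Topology

/-- Behavior of the squared Föllmer diffusion coefficient
`|g^F_s|² = 2sσ_s(β_s⁻¹β'_s σ_s − σ'_s) − σ_s²` near `s = 0`:
`s⁻¹(|g^F_s|² − σ_s²) → σ(0)² β''(0)/β'(0) − 2σ'(0)σ(0)` as `s → 0⁺`. -/
theorem follmer_diffusion_limit_at_zero
    (δ : ℝ) (hδ : 0 < δ)
    (β β' σ σ' : ℝ → ℝ) (β'' : ℝ)
    (hβ0 : β 0 = 0)
    (hβd : ∀ u ∈ Set.Ico (0 : ℝ) δ, HasDerivWithinAt β (β' u) (Set.Ico 0 δ) u)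
    (hβ'0 : 0 < β' 0)
    (hβpos : ∀ u ∈ Set.Ioo (0 : ℝ) δ, 0 < β u)
    (hβ'' : HasDerivWithinAt β' β'' (Set.Ico 0 δ) 0)
    (hσd : ∀ u ∈ Set.Ico (0 : ℝ) δ, HasDerivWithinAt σ (σ' u) (Set.Ico 0 δ) u)
    (hσ'c : ContinuousOn σ' (Set.Ico 0 δ))
    (hσ0 : 0 < σ 0)
    (gF2 : ℝ → ℝ)
    (hgF2 : ∀ u ∈ Set.Ioo (0 : ℝ) δ,
      gF2 u = 2 * u * σ u * ((β u)⁻¹ * β' u * σ u - σ' u) - σ u ^ 2) :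
    Tendsto (fun s => (gF2 s - σ s ^ 2) / s) (nhdsWithin 0 (Set.Ioo 0 δ))
      (nhds (σ 0 ^ 2 * β'' / β' 0 - 2 * σ' 0 * σ 0)) := by
  rw [nhdsWithin_Ioo_eq_nhdsGT hδ]
  have h0 : (0:ℝ) ∈ Set.Ico 0 δ := ⟨le_rfl, hδ⟩
  have hmem : ∀ᶠ s in 𝓝[>] (0:ℝ), s ∈ Set.Ioo 0 δ := Ioo_mem_nhdsGT hδ
  have hle : 𝓝[>] (0:ℝ) ≤ 𝓝[Set.Ico 0 δ] 0 := by
    rw [← nhdsWithin_Ioo_eq_nhdsGT hδ]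
    exact nhdsWithin_mono _ Set.Ioo_subset_Ico_self
  have hσt : Tendsto σ (𝓝[>] 0) (𝓝 (σ 0)) := (hσd 0 h0).continuousWithinAt.mono_left hle
  have hσ't : Tendsto σ' (𝓝[>] 0) (𝓝 (σ' 0)) := (hσ'c 0 h0).mono_left hle
  have hβt : Tendsto β (𝓝[>] 0) (𝓝 0) := by
    have := (hβd 0 h0).continuousWithinAt.mono_left hle
    rwa [hβ0] at this
  have hid : Tendsto (fun s : ℝ => s) (𝓝[>] 0) (𝓝 0) := tendsto_nhdsWithin_of_tendsto_nhds tendsto_id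
  have hslope : ∀ (f : ℝ → ℝ) (c : ℝ), HasDerivWithinAt f c (Set.Ico 0 δ) 0 →
      Tendsto (fun s => (f s - f 0) / s) (𝓝[>] 0) (𝓝 c) := by
    intro f c h
    have h1 : HasDerivWithinAt f c (Set.Ioo 0 δ) 0 := h.mono Set.Ioo_subset_Ico_self
    rw [hasDerivWithinAt_iff_tendsto_slope' (by simp), nhdsWithin_Ioo_eq_nhdsGT hδ] at h1
    refine h1.congr fun s => ?_
    simp [slope_def_field]
  have hq1 := hslope β' β'' hβ''
  have hq2 := hslope β _ (hβd 0 h0)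
  have hL : Tendsto (fun s => (β s - s * β' 0) / s ^ 2) (𝓝[>] 0) (𝓝 (β'' / 2)) := by
    refine HasDerivAt.lhopital_zero_right_on_Ioo (f' := fun s => β' s - β' 0)
      (g' := fun s => 2 * s) hδ ?_ ?_ ?_ ?_ ?_ ?_
    · intro x hx
      have h1 : HasDerivAt β (β' x) x :=
        (hβd x (Set.Ioo_subset_Ico_self hx)).hasDerivAt (Ico_mem_nhds hx.1 hx.2)
      have h2 := h1.sub ((hasDerivAt_id x).mul_const (β' 0))
      rw [one_mul] at h2
      exact h2
    · intro x _
      simpa using hasDerivAt_pow 2 x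
    · intro x hx
      have := hx.1
      positivity
    · simpa using hβt.sub (hid.mul_const (β' 0))
    · simpa using hid.pow 2
    · refine (hq1.div_const 2).congr fun s => ?_
      rw [div_div, mul_comm s 2]
  have hinv := hq2.inv₀ hβ'0.ne'
  have key := ((((hσt.pow 2).const_mul 2).mul (hq1.sub hL)).mul hinv).sub
    ((hσt.mul hσ't).const_mul 2)
  have e : 2 * σ 0 ^ 2 * (β'' - β'' / 2) * (β' 0)⁻¹ - 2 * (σ 0 * σ' 0)
      = σ 0 ^ 2 * β'' / β' 0 - 2 * σ' 0 * σ 0 := by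
    field_simp
    ring
  rw [e] at key
  refine key.congr' ?_
  filter_upwards [hmem] with s hs
  have hs0 : s ≠ 0 := hs.1.ne'
  have hb : β s ≠ 0 := (hβpos s hs).ne'
  rw [hgF2 s hs, hβ0, sub_zero]
  field_simp
  ring
end
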